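/- arXiv:2002.06467 — 2 statements merged into one kernel-verified Lean document; each statement's English description precedes it below -/
import Mathlib

section
/- Let μ₁, μ₂, μ₃ be probability measures on ℝ and suppose there exists a measurable set A ⊆ ℝ with μ₃(A) = 0, μ₁(A) > 0, and μ₂(A) > 0. Then there is no probability measure P on Bool × ℝ such that: (i) the pushforward of P under Prod.snd equals μ₃, and (ii) for every measurable B ⊆ ℝ, P({true} × B) = P({true} × ℝ)·μ₁(B) and P({false} × B) = P({false} × ℝ)·μ₂(B). -/
open MeasureTheory

/-- If μ₃ has a null set on which μ₁ and μ₂ are positive, then no joint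
probability measure on Bool × ℝ has second marginal μ₃ and conditional slices μ₁, μ₂. -/
theorem no_joint_distribution
    (μ₁ μ₂ μ₃ : Measure ℝ)
    [IsProbabilityMeasure μ₁] [IsProbabilityMeasure μ₂] [IsProbabilityMeasure μ₃]
    (h : ∃ A : Set ℝ, MeasurableSet A ∧ μ₃ A = 0 ∧ 0 < μ₁ A ∧ 0 < μ₂ A) :
    ¬ ∃ P : Measure (Bool × ℝ), IsProbabilityMeasure P ∧
      P.map Prod.snd = μ₃ ∧
      (∀ B : Set ℝ, MeasurableSet B →
        P (({true} : Set Bool) ×ˢ B)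
          = P (({true} : Set Bool) ×ˢ (Set.univ : Set ℝ)) * μ₁ B) ∧
      (∀ B : Set ℝ, MeasurableSet B →
        P (({false} : Set Bool) ×ˢ B)
          = P (({false} : Set Bool) ×ˢ (Set.univ : Set ℝ)) * μ₂ B) := by
  rintro ⟨P, hP, hsnd, htrue, hfalse⟩
  obtain ⟨A, hA, hA₃, hA₁, hA₂⟩ := h
  have hnull : P (Prod.snd ⁻¹' A) = 0 := by
    rw [← Measure.map_apply measurable_snd hA, hsnd, hA₃]
  have slice (b : Bool) : P (({b} : Set Bool) ×ˢ A) = 0 :=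
    measure_mono_null (fun _ hx => hx.2) hnull
  have ht : P (({true} : Set Bool) ×ˢ (Set.univ : Set ℝ)) = 0 :=
    (mul_eq_zero.mp ((htrue A hA).symm.trans (slice true))).resolve_right hA₁.ne'
  have hf : P (({false} : Set Bool) ×ˢ (Set.univ : Set ℝ)) = 0 :=
    (mul_eq_zero.mp ((hfalse A hA).symm.trans (slice false))).resolve_right hA₂.ne'
  have huniv : P Set.univ = 0 := by
    refine measure_mono_null ?_ (measure_union_null ht hf)
    rintro ⟨_ | _, y⟩ - <;> simp
  simp at huniv
end

section
/- Let L : ℝ → ℝ be a nonnegative, measurable, Lebesgue-integrable function. For σ > 0 define the marginal likelihood m(σ) = ∫ (1/(σ·√(2π)))·exp(−θ²/(2σ²))·L(θ) dθ. Then σ·m(σ) → (1/√(2π))·∫ L(θ) dθ as σ → ∞. -/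
open MeasureTheory Real Filter

/-- The integral of an integrable function against the Gaussian kernel `exp (-θ² / (2σ²))`
converges to its Lebesgue integral as `σ → ∞`. -/
theorem tendsto_integral_exp_neg_sq_div_mul {L : ℝ → ℝ} (hint : Integrable L) :
    Tendsto (fun σ : ℝ => ∫ θ : ℝ, Real.exp (-θ ^ 2 / (2 * σ ^ 2)) * L θ)
      atTop (nhds (∫ θ : ℝ, L θ)) := by
  refine tendsto_integral_filter_of_dominated_convergence (fun θ => ‖L θ‖)
    (Eventually.of_forall fun σ => ?_) (Eventually.of_forall fun σ => ae_of_all _ fun θ => ?_)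
    hint.norm (ae_of_all _ fun θ => ?_)
  · have : Continuous fun θ : ℝ => Real.exp (-θ ^ 2 / (2 * σ ^ 2)) := by fun_prop
    exact this.aestronglyMeasurable.mul hint.aestronglyMeasurable
  · rw [norm_mul, Real.norm_of_nonneg (Real.exp_pos _).le]
    refine mul_le_of_le_one_left (norm_nonneg _) (Real.exp_le_one_iff.2 ?_)
    exact div_nonpos_of_nonpos_of_nonneg (neg_nonpos.2 (sq_nonneg θ)) (by positivity)
  · have hσ : Tendsto (fun σ : ℝ => 2 * σ ^ 2) atTop atTop :=
      (tendsto_pow_atTop two_ne_zero).const_mul_atTop two_pos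
    have hexp := (Real.continuous_exp.tendsto 0).comp (hσ.const_div_atTop (-θ ^ 2))
    simpa using hexp.mul_const (L θ)

/-- as the normal(0, σ²) prior becomes flat, the marginal likelihood m(σ)
scales like (1/σ)·(1/√(2π))·∫L. -/
theorem marginal_likelihood_flat_prior_limit
    (L : ℝ → ℝ) (hL : ∀ θ, 0 ≤ L θ) (hmeas : Measurable L) (hint : Integrable L) :
    Tendsto
      (fun σ : ℝ => σ * ∫ θ : ℝ,
        (1 / (σ * Real.sqrt (2 * Real.pi))) * Real.exp (-θ ^ 2 / (2 * σ ^ 2)) * L θ)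
      atTop
      (nhds ((1 / Real.sqrt (2 * Real.pi)) * ∫ θ : ℝ, L θ)) := by
  refine ((tendsto_integral_exp_neg_sq_div_mul hint).const_mul
    (1 / Real.sqrt (2 * Real.pi))).congr' ?_
  filter_upwards [eventually_gt_atTop 0] with σ hσ
  simp_rw [mul_assoc (1 / (σ * _))]
  rw [integral_const_mul, ← mul_assoc]
  congr 1
  field_simp
end
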